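/- arXiv:2107.03812 — 7 statements merged into one kernel-verified Lean document; each statement's English description precedes it below -/
import Mathlib

section
/- Let a, b > 0 and define f(t) = sinh²((a−b)t) / (sinh(2at) · sinh(2bt)) for t > 0. If a ≠ b, then for every t > 0 one has 0 < f(t) < (a−b)²/(4ab). -/
theorem Real.strictConvexOn_sinh : StrictConvexOn ℝ (Set.Ici 0) Real.sinh := by
  refine StrictMonoOn.strictConvexOn_of_deriv (convex_Ici 0) Real.continuous_sinh.continuousOn ?_
  rw [Real.deriv_sinh]
  exact Real.cosh_strictMonoOn.mono interior_subset

theorem Real.mul_sinh_lt_mul_sinh {p q : ℝ} (hq : 0 < q) (hqp : q < p) :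
    p * Real.sinh q < q * Real.sinh p := by
  have hp : 0 < p := hq.trans hqp
  have h := Real.strictConvexOn_sinh.2 (Set.mem_Ici.2 hp.le) (Set.mem_Ici.2 le_rfl) hp.ne'
    (div_pos hq hp) (sub_pos.2 ((div_lt_one hp).2 hqp)) (by ring)
  simp only [smul_eq_mul, mul_zero, add_zero, Real.sinh_zero, div_mul_cancel₀ _ hp.ne'] at h
  calc p * Real.sinh q < p * (q / p * Real.sinh p) := mul_lt_mul_of_pos_left h hp
    _ = q * Real.sinh p := by field_simp

theorem Real.sq_mul_sinh_sq_lt {p q : ℝ} (hq : q ≠ 0) (hqp : |q| < p) :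
    p ^ 2 * Real.sinh q ^ 2 < q ^ 2 * Real.sinh p ^ 2 := by
  have hq' : 0 < |q| := abs_pos.2 hq
  have hp : 0 < p := hq'.trans hqp
  have h := pow_lt_pow_left₀ (Real.mul_sinh_lt_mul_sinh hq' hqp)
    (mul_nonneg hp.le (Real.sinh_nonneg_iff.2 hq'.le)) two_ne_zero
  rwa [mul_pow, mul_pow, ← Real.abs_sinh, sq_abs, sq_abs] at h

theorem Real.sinh_two_mul_mul_sinh_two_mul (x y : ℝ) :
    Real.sinh (2 * x) * Real.sinh (2 * y) = Real.sinh (x + y) ^ 2 - Real.sinh (x - y) ^ 2 := by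
  rw [Real.sinh_two_mul, Real.sinh_two_mul, Real.sinh_add, Real.sinh_sub]
  ring

/-- Lemma (NN, item 1): for `a, b > 0` with `a ≠ b`, the function
`f(t) = sinh²((a−b)t) / (sinh(2at)·sinh(2bt))` satisfies
`0 < f(t) < (a−b)²/(4ab)` for every `t > 0`. -/
theorem nn_lemma_bounds (a b : ℝ) (ha : 0 < a) (hb : 0 < b) (hab : a ≠ b)
    (f : ℝ → ℝ)
    (hf : ∀ t, f t = Real.sinh ((a - b) * t) ^ 2 /
      (Real.sinh (2 * a * t) * Real.sinh (2 * b * t))) :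
    ∀ t > 0, 0 < f t ∧ f t < (a - b) ^ 2 / (4 * a * b) := by
  intro t ht
  have hx : 0 < a * t := mul_pos ha ht
  have hy : 0 < b * t := mul_pos hb ht
  have hq : (a - b) * t ≠ 0 := mul_ne_zero (sub_ne_zero.2 hab) ht.ne'
  have hD : 0 < Real.sinh (2 * a * t) * Real.sinh (2 * b * t) :=
    mul_pos (Real.sinh_pos_iff.2 (by positivity)) (Real.sinh_pos_iff.2 (by positivity))
  rw [hf]
  refine ⟨div_pos (sq_pos_of_ne_zero (mt Real.sinh_eq_zero.1 hq)) hD, ?_⟩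
  have hqp : |(a - b) * t| < (a + b) * t := abs_lt.2 ⟨by linarith, by linarith⟩
  have h := Real.sq_mul_sinh_sq_lt hq hqp
  rw [div_lt_div_iff₀ hD (by positivity), mul_assoc 2 a t, mul_assoc 2 b t,
    Real.sinh_two_mul_mul_sinh_two_mul, ← add_mul, ← sub_mul]
  refine lt_of_mul_lt_mul_right ?_ (sq_nonneg t)
  linarith
end

section
/- Let a, b > 0 with a ≠ b and define f(t) = sinh²((a−b)t) / (sinh(2at) · sinh(2bt)) for t > 0. Then f is strictly monotonically decreasing on (0, ∞). -/
open Real in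
/-- For `0 < d < s`, the numerator of the derivative of `sinh (s * t) / sinh (d * t)` is positive. -/
lemma mul_sinh_mul_cosh_lt {d s t : ℝ} (hd : 0 < d) (hds : d < s) (ht : 0 < t) :
    d * sinh (s * t) * cosh (d * t) < s * cosh (s * t) * sinh (d * t) := by
  have hderiv (u : ℝ) : HasDerivAt
      (fun t ↦ s * cosh (s * t) * sinh (d * t) - d * sinh (s * t) * cosh (d * t))
      ((s ^ 2 - d ^ 2) * (sinh (s * u) * sinh (d * u))) u := by
    have hs := (hasDerivAt_id u).const_mul s
    have hd := (hasDerivAt_id u).const_mul d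
    refine (((hs.cosh.const_mul s).mul hd.sinh).sub
      ((hs.sinh.const_mul d).mul hd.cosh)).congr_deriv ?_
    simp only [id]
    ring
  have hmono : StrictMonoOn
      (fun t ↦ s * cosh (s * t) * sinh (d * t) - d * sinh (s * t) * cosh (d * t))
      (Set.Ici 0) := by
    refine strictMonoOn_of_deriv_pos (convex_Ici 0)
      (fun u _ ↦ (hderiv u).continuousAt.continuousWithinAt) fun u hu ↦ ?_
    rw [interior_Ici] at hu
    have hu : 0 < u := hu
    rw [(hderiv u).deriv]
    have hsu : 0 < sinh (s * u) := sinh_pos_iff.2 (mul_pos (hd.trans hds) hu)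
    have hdu : 0 < sinh (d * u) := sinh_pos_iff.2 (mul_pos hd hu)
    have hsq : 0 < s ^ 2 - d ^ 2 := by nlinarith
    positivity
  have h := hmono Set.self_mem_Ici (Set.mem_Ici.2 ht.le) ht
  simp only [mul_zero, sinh_zero, zero_mul, sub_zero] at h
  linarith

open Real in
lemma strictMonoOn_sinh_mul_div_sinh_mul {d s : ℝ} (hd : 0 < d) (hds : d < s) :
    StrictMonoOn (fun t ↦ sinh (s * t) / sinh (d * t)) (Set.Ioi 0) := by
  have hderiv {u : ℝ} (hu : 0 < u) := ((hasDerivAt_id u).const_mul s).sinh.div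
    ((hasDerivAt_id u).const_mul d).sinh (sinh_pos_iff.2 (mul_pos hd hu)).ne'
  refine strictMonoOn_of_deriv_pos (convex_Ioi 0)
    (fun u hu ↦ (hderiv hu).continuousAt.continuousWithinAt) fun u hu ↦ ?_
  rw [interior_Ioi] at hu
  have hu : 0 < u := hu
  refine (hderiv hu).deriv.symm ▸ div_pos ?_ (pow_pos (sinh_pos_iff.2 (mul_pos hd hu)) 2)
  have := mul_sinh_mul_cosh_lt hd hds hu
  simp only [id]
  linarith

open Real in
lemma sinh_add_mul_sinh_sub (x y : ℝ) :
    sinh (x + y) * sinh (x - y) = sinh x ^ 2 - sinh y ^ 2 := by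
  rw [sinh_add, sinh_sub]
  linear_combination sinh x ^ 2 * cosh_sq y - sinh y ^ 2 * cosh_sq x

open Real in
lemma strictAntiOn_sinh_sq_div_of_lt {a b : ℝ} (hb : 0 < b) (hba : b < a) :
    StrictAntiOn (fun t ↦ sinh ((a - b) * t) ^ 2 / (sinh (2 * a * t) * sinh (2 * b * t)))
      (Set.Ioi 0) := by
  intro x (hx : 0 < x) y (hy : 0 < y) hxy
  have hd : 0 < a - b := sub_pos.2 hba
  have hprod (t : ℝ) : sinh (2 * a * t) * sinh (2 * b * t) =
      sinh ((a + b) * t) ^ 2 - sinh ((a - b) * t) ^ 2 := by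
    rw [← sinh_add_mul_sinh_sub]
    ring_nf
  have hpos {t : ℝ} (ht : 0 < t) : 0 < sinh (2 * a * t) * sinh (2 * b * t) :=
    mul_pos (sinh_pos_iff.2 (by have := hb.trans hba; positivity)) (sinh_pos_iff.2 (by positivity))
  have hdx : 0 < sinh ((a - b) * x) := sinh_pos_iff.2 (mul_pos hd hx)
  have hdy : 0 < sinh ((a - b) * y) := sinh_pos_iff.2 (mul_pos hd hy)
  have hsx : 0 < sinh ((a + b) * x) := sinh_pos_iff.2 (mul_pos (by linarith) hx)
  have h : sinh ((a + b) * x) / sinh ((a - b) * x) < sinh ((a + b) * y) / sinh ((a - b) * y) :=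
    strictMonoOn_sinh_mul_div_sinh_mul hd (by linarith) hx hy hxy
  rw [div_lt_div_iff₀ hdx hdy] at h
  have hsq := pow_lt_pow_left₀ h (by positivity) two_ne_zero
  simp only
  rw [div_lt_div_iff₀ (hpos hy) (hpos hx), hprod, hprod]
  linarith

/-- Lemma (NN, item 2): for `a, b > 0` with `a ≠ b`, the function
`f(t) = sinh²((a−b)t) / (sinh(2at)·sinh(2bt))` is strictly monotonically
decreasing on `(0, ∞)`. -/
theorem nn_lemma_strict_anti (a b : ℝ) (ha : 0 < a) (hb : 0 < b) (hab : a ≠ b)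
    (f : ℝ → ℝ)
    (hf : ∀ t, f t = Real.sinh ((a - b) * t) ^ 2 /
      (Real.sinh (2 * a * t) * Real.sinh (2 * b * t))) :
    StrictAntiOn f (Set.Ioi (0 : ℝ)) := by
  obtain rfl : f = _ := funext hf
  rcases hab.lt_or_gt with h | h
  · refine (strictAntiOn_sinh_sq_div_of_lt ha h).congr fun t _ ↦ ?_
    simp only
    rw [mul_comm (Real.sinh (2 * b * t)), ← neg_sub a b, neg_mul, Real.sinh_neg, neg_sq]
  · exact strictAntiOn_sinh_sq_div_of_lt hb h
end

section
/- For all real a, b, t > 0 with a ≠ b, one has (a−b)·coth((a−b)t) < a·coth(2at) + b·coth(2bt). (Note that s·coth(st) is unchanged under s ↦ −s, so the left-hand side is well defined and positive regardless of the sign of a−b.) -/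
/-- The hyperbolic cotangent `coth x = cosh x / sinh x`. -/
noncomputable def coth (x : ℝ) : ℝ := Real.cosh x / Real.sinh x

theorem mul_sinh_lt_mul_sinh {x y : ℝ} (hy : 0 < y) (hyx : y < x) :
    x * Real.sinh y < y * Real.sinh x := by
  have hmono : StrictMonoOn (fun z ↦ y * Real.sinh z - z * Real.sinh y) (Set.Ici y) := by
    refine strictMonoOn_of_deriv_pos (convex_Ici y) (by fun_prop) fun z hz ↦ ?_
    rw [interior_Ici, Set.mem_Ioi] at hz
    have hderiv : HasDerivAt (fun z ↦ y * Real.sinh z - z * Real.sinh y)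
        (y * Real.cosh z - 1 * Real.sinh y) z :=
      ((Real.hasDerivAt_sinh z).const_mul y).sub ((hasDerivAt_id z).mul_const _)
    have hcosh : Real.cosh y < Real.cosh z := by
      rwa [Real.cosh_lt_cosh, abs_of_pos hy, abs_of_pos (hy.trans hz)]
    have hsinh : Real.sinh y ≤ y * Real.cosh y := by
      have hmono_aux : MonotoneOn (fun w ↦ w * Real.cosh w - Real.sinh w) (Set.Ici 0) := by
        refine monotoneOn_of_deriv_nonneg (convex_Ici 0) (by fun_prop) (by fun_prop) fun w hw ↦ ?_
        rw [interior_Ici, Set.mem_Ioi] at hw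
        have hd : HasDerivAt (fun w ↦ w * Real.cosh w - Real.sinh w)
            (1 * Real.cosh w + w * Real.sinh w - Real.cosh w) w :=
          ((hasDerivAt_id w).mul (Real.hasDerivAt_cosh w)).sub (Real.hasDerivAt_sinh w)
        rw [hd.deriv]
        linarith [mul_pos hw (Real.sinh_pos_iff.2 hw)]
      simpa using hmono_aux Set.self_mem_Ici hy.le hy.le
    rw [hderiv.deriv]
    linarith [mul_lt_mul_of_pos_left hcosh hy]
  simpa using hmono Set.self_mem_Ici hyx.le hyx

theorem coth_neg (x : ℝ) : coth (-x) = -coth x := by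
  simp [coth, div_neg]

theorem coth_sub_coth {u v : ℝ} (hu : Real.sinh u ≠ 0) (hv : Real.sinh v ≠ 0) :
    coth u - coth v = Real.sinh (v - u) / (Real.sinh u * Real.sinh v) := by
  rw [coth, coth, Real.sinh_sub]
  field_simp

theorem coth_inequality_of_lt {a b t : ℝ} (hb : 0 < b) (ht : 0 < t) (hab : b < a) :
    (a - b) * coth ((a - b) * t) < a * coth (2 * a * t) + b * coth (2 * b * t) := by
  have ha : 0 < a := hb.trans hab
  have hsd : 0 < Real.sinh ((a - b) * t) := Real.sinh_pos_iff.2 (mul_pos (sub_pos.2 hab) ht)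
  have hsa : 0 < Real.sinh (2 * a * t) := Real.sinh_pos_iff.2 (by positivity)
  have hsb : 0 < Real.sinh (2 * b * t) := Real.sinh_pos_iff.2 (by positivity)
  have hsm : 0 < Real.sinh ((a + b) * t) := Real.sinh_pos_iff.2 (by positivity)
  have hA := coth_sub_coth hsd.ne' hsa.ne'
  have hB := coth_sub_coth (v := -(2 * b * t)) hsd.ne' (by simpa using hsb.ne')
  rw [show 2 * a * t - (a - b) * t = (a + b) * t by ring] at hA
  rw [show -(2 * b * t) - (a - b) * t = -((a + b) * t) by ring, coth_neg, Real.sinh_neg,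
    Real.sinh_neg, mul_neg, neg_div_neg_eq, sub_neg_eq_add] at hB
  have hkey : a * Real.sinh (2 * b * t) < b * Real.sinh (2 * a * t) := by
    have h := mul_sinh_lt_mul_sinh (x := 2 * a * t) (y := 2 * b * t) (by positivity) (by gcongr)
    refine lt_of_mul_lt_mul_left (a := 2 * t) ?_ (by positivity)
    linarith
  have hdiff : a * coth (2 * a * t) + b * coth (2 * b * t) - (a - b) * coth ((a - b) * t) =
      Real.sinh ((a + b) * t) * (b * Real.sinh (2 * a * t) - a * Real.sinh (2 * b * t)) /
        (Real.sinh ((a - b) * t) * Real.sinh (2 * a * t) * Real.sinh (2 * b * t)) := by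
    trans b * (coth ((a - b) * t) + coth (2 * b * t)) -
      a * (coth ((a - b) * t) - coth (2 * a * t))
    · ring
    · rw [hA, hB]
      field_simp
  rw [← sub_pos, hdiff]
  have := sub_pos.2 hkey
  positivity

/-- For all real `a, b, t > 0` with `a ≠ b`, one has
`(a−b)·coth((a−b)t) < a·coth(2at) + b·coth(2bt)`. -/
theorem coth_inequality (a b t : ℝ) (ha : 0 < a) (hb : 0 < b) (ht : 0 < t)
    (hab : a ≠ b) :
    (a - b) * coth ((a - b) * t) < a * coth (2 * a * t) + b * coth (2 * b * t) := by
  rcases hab.lt_or_gt with h | h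
  · have hlt := coth_inequality_of_lt ha ht h
    rwa [← neg_sub a b, neg_mul (a - b) t, coth_neg, neg_mul_neg, add_comm] at hlt
  · exact coth_inequality_of_lt hb ht h
end

section
/- The function g(t) = t·coth(t) is strictly convex on (0, ∞). -/
theorem Real.sinh_lt_mul_cosh {x : ℝ} (hx : 0 < x) : Real.sinh x < x * Real.cosh x := by
  have hderiv (y : ℝ) :
      HasDerivAt (fun z : ℝ => z * Real.cosh z - Real.sinh z) (y * Real.sinh y) y := by
    refine (((hasDerivAt_id' y).mul (Real.hasDerivAt_cosh y)).sub
      (Real.hasDerivAt_sinh y)).congr_deriv ?_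
    ring
  have hmono : StrictMonoOn (fun z : ℝ => z * Real.cosh z - Real.sinh z) (Set.Ici 0) := by
    refine strictMonoOn_of_deriv_pos (convex_Ici 0)
      (fun y _ => (hderiv y).continuousAt.continuousWithinAt) fun y hy => ?_
    rw [interior_Ici] at hy
    rw [(hderiv y).deriv]
    exact mul_pos hy (Real.sinh_pos_iff.2 hy)
  simpa using hmono Set.self_mem_Ici hx.le hx

theorem hasDerivAt_coth {x : ℝ} (hx : x ≠ 0) : HasDerivAt coth (-1 / Real.sinh x ^ 2) x := by
  have hs : Real.sinh x ≠ 0 := Real.sinh_ne_zero.2 hx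
  refine ((Real.hasDerivAt_cosh x).div (Real.hasDerivAt_sinh x) hs).congr_deriv ?_
  congr 1
  linear_combination -Real.cosh_sq x

theorem hasDerivAt_mul_coth {x : ℝ} (hx : x ≠ 0) :
    HasDerivAt (fun t : ℝ => t * coth t) (coth x - x / Real.sinh x ^ 2) x := by
  refine ((hasDerivAt_id' x).mul (hasDerivAt_coth hx)).congr_deriv ?_
  ring

theorem hasDerivAt_coth_sub_div_sinh_sq {x : ℝ} (hx : x ≠ 0) :
    HasDerivAt (fun t : ℝ => coth t - t / Real.sinh t ^ 2)
      (2 * (x * Real.cosh x - Real.sinh x) / Real.sinh x ^ 3) x := by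
  have hs : Real.sinh x ≠ 0 := Real.sinh_ne_zero.2 hx
  refine ((hasDerivAt_coth hx).sub ((hasDerivAt_id' x).div
    ((Real.hasDerivAt_sinh x).pow 2) (pow_ne_zero 2 hs))).congr_deriv ?_
  simp only [Pi.pow_apply]
  field_simp
  ring

/-- The function `g(t) = t·coth(t)` is strictly convex on `(0, ∞)`. -/
theorem mul_coth_strictConvexOn :
    StrictConvexOn ℝ (Set.Ioi (0 : ℝ)) (fun t : ℝ => t * coth t) := by
  refine strictConvexOn_of_deriv2_pos' (convex_Ioi 0)
    (fun x hx => (hasDerivAt_mul_coth (ne_of_gt hx)).continuousAt.continuousWithinAt)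
    fun x hx => ?_
  have hderiv : deriv (fun t : ℝ => t * coth t) =ᶠ[nhds x]
      fun t => coth t - t / Real.sinh t ^ 2 := by
    filter_upwards [Ioi_mem_nhds hx] with y hy
    exact (hasDerivAt_mul_coth (ne_of_gt hy)).deriv
  rw [Function.iterate_succ_apply, Function.iterate_one, hderiv.deriv_eq,
    (hasDerivAt_coth_sub_div_sinh_sq (ne_of_gt hx)).deriv]
  have hs : 0 < Real.sinh x := Real.sinh_pos_iff.2 hx
  have hlt : 0 < x * Real.cosh x - Real.sinh x := sub_pos.2 (Real.sinh_lt_mul_cosh hx)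
  positivity
end

section
/- Let δ > 0, let λ₁ ≠ λ₂ be real numbers with λ := λ₁ − λ₂ ≠ 0, let ρ₁, ρ₂ and θ be real, and let P be the 2×2 real matrix P = [[1 − θ(λ₁ρ₁ − λ₂ρ₂)/λ, θ·δλ₁λ₂(ρ₁ − ρ₂)/λ], [θ(ρ₂ − ρ₁)/(δλ), 1 − θ(λ₁ρ₂ − λ₂ρ₁)/λ]]. Then the trace of P equals 2 − θ(ρ₁ + ρ₂) and the determinant of P equals (1 − θρ₁)(1 − θρ₂); equivalently, the eigenvalues of P are 1 − θρ₁ and 1 − θρ₂. -/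
/-- The Neumann–Neumann iteration matrix
`P = [[1 − θ(λ₁ρ₁ − λ₂ρ₂)/λ, θδλ₁λ₂(ρ₁ − ρ₂)/λ], [θ(ρ₂ − ρ₁)/(δλ), 1 − θ(λ₁ρ₂ − λ₂ρ₁)/λ]]`
has trace `2 − θ(ρ₁ + ρ₂)` and determinant `(1 − θρ₁)(1 − θρ₂)`; equivalently its
eigenvalues are `1 − θρ₁` and `1 − θρ₂`. -/
theorem nn_iteration_matrix_spectrum (δ lam₁ lam₂ lam ρ₁ ρ₂ θ : ℝ)
    (hδ : 0 < δ) (hne : lam₁ ≠ lam₂) (hlam : lam = lam₁ - lam₂)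
    (P : Matrix (Fin 2) (Fin 2) ℝ)
    (hP : P = !![1 - θ * (lam₁ * ρ₁ - lam₂ * ρ₂) / lam,
                   θ * (δ * lam₁ * lam₂ * (ρ₁ - ρ₂)) / lam;
                 θ * (ρ₂ - ρ₁) / (δ * lam),
                   1 - θ * (lam₁ * ρ₂ - lam₂ * ρ₁) / lam]) :
    Matrix.trace P = 2 - θ * (ρ₁ + ρ₂) ∧
      Matrix.det P = (1 - θ * ρ₁) * (1 - θ * ρ₂) ∧
      ∀ μ : ℝ, Matrix.det (μ • (1 : Matrix (Fin 2) (Fin 2) ℝ) - P) = 0 ↔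
        μ = 1 - θ * ρ₁ ∨ μ = 1 - θ * ρ₂ := by
  have hsub : lam₁ - lam₂ ≠ 0 := sub_ne_zero.mpr hne
  have hδ₀ : δ ≠ 0 := hδ.ne'
  subst hlam
  have htrace : P.trace = 2 - θ * (ρ₁ + ρ₂) := by
    rw [hP, Matrix.trace_fin_two_of]
    field_simp
    ring
  have hdet : P.det = (1 - θ * ρ₁) * (1 - θ * ρ₂) := by
    rw [hP, Matrix.det_fin_two_of]
    field_simp
    ring
  refine ⟨htrace, hdet, fun μ => ?_⟩
  have hchar : (μ • (1 : Matrix (Fin 2) (Fin 2) ℝ) - P).det =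
      (μ - (1 - θ * ρ₁)) * (μ - (1 - θ * ρ₂)) := by
    rw [Matrix.trace_fin_two] at htrace
    rw [Matrix.det_fin_two] at hdet
    simp only [Matrix.det_fin_two, Matrix.sub_apply, Matrix.smul_apply, Matrix.one_apply_eq,
      Matrix.one_apply_ne (zero_ne_one' (Fin 2)), Matrix.one_apply_ne (one_ne_zero' (Fin 2)),
      smul_eq_mul]
    linear_combination hdet - μ * htrace
  rw [hchar, mul_eq_zero, sub_eq_zero, sub_eq_zero]
end

section
/- Let δ > 0, λ₁ ≠ λ₂ real with λ = λ₁ − λ₂, θ real, and suppose ρ₁ = ρ₂ = 4 (the symmetric-subdomain case a = b). Then the iteration matrix P = [[1 − θ(λ₁ρ₁ − λ₂ρ₂)/λ, θδλ₁λ₂(ρ₁ − ρ₂)/λ], [θ(ρ₂ − ρ₁)/(δλ), 1 − θ(λ₁ρ₂ − λ₂ρ₁)/λ]] equals (1 − 4θ) times the identity matrix. Consequently, for every initial vector v ∈ ℝ², the iterates Pᵏ v converge to 0 as k → ∞ whenever 0 < θ < 1/2, and Pᵏ v = 0 for all k ≥ 1 when θ = 1/4; moreover if θ ≥ 1/2 and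 v ≠ 0 the iterates do not converge to 0. -/
open Filter Topology

/-- The iterates of a scalar matrix act on vectors by powers of the scalar. -/
theorem Matrix.smul_one_pow_mulVec {n R : Type*} [Fintype n] [DecidableEq n] [CommSemiring R]
    (c : R) (k : ℕ) (v : n → R) :
    ((c • (1 : Matrix n n R)) ^ k).mulVec v = c ^ k • v := by
  rw [smul_pow, one_pow, Matrix.smul_mulVec, Matrix.one_mulVec]

/-- Symmetric-subdomain case `ρ₁ = ρ₂ = 4`: the NN iteration matrix equals
`(1 − 4θ)·I`.  Consequently, for every initial vector `v ∈ ℝ²`, the iterates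
`Pᵏ v` converge to `0` whenever `0 < θ < 1/2`, vanish for all `k ≥ 1` when
`θ = 1/4`, and do not converge to `0` when `θ ≥ 1/2` and `v ≠ 0`. -/
theorem nn_symmetric_case (δ lam₁ lam₂ lam ρ₁ ρ₂ θ : ℝ)
    (hδ : 0 < δ) (hne : lam₁ ≠ lam₂) (hlam : lam = lam₁ - lam₂)
    (hρ₁ : ρ₁ = 4) (hρ₂ : ρ₂ = 4)
    (P : Matrix (Fin 2) (Fin 2) ℝ)
    (hP : P = !![1 - θ * (lam₁ * ρ₁ - lam₂ * ρ₂) / lam,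
                   θ * (δ * lam₁ * lam₂ * (ρ₁ - ρ₂)) / lam;
                 θ * (ρ₂ - ρ₁) / (δ * lam),
                   1 - θ * (lam₁ * ρ₂ - lam₂ * ρ₁) / lam]) :
    P = (1 - 4 * θ) • (1 : Matrix (Fin 2) (Fin 2) ℝ) ∧
      ∀ v : Fin 2 → ℝ,
        (0 < θ → θ < 1 / 2 →
          Tendsto (fun k : ℕ => (P ^ k).mulVec v) atTop (𝓝 0)) ∧
        (θ = 1 / 4 → ∀ k : ℕ, 1 ≤ k → (P ^ k).mulVec v = 0) ∧
        (θ ≥ 1 / 2 → v ≠ 0 →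
          ¬ Tendsto (fun k : ℕ => (P ^ k).mulVec v) atTop (𝓝 0)) := by
  have hlam0 : lam₁ - lam₂ ≠ 0 := sub_ne_zero.mpr hne
  have hscalar : P = (1 - 4 * θ) • (1 : Matrix (Fin 2) (Fin 2) ℝ) := by
    subst hP hρ₁ hρ₂ hlam
    ext i j
    fin_cases i <;> fin_cases j <;> simp <;> field_simp
  refine ⟨hscalar, fun v => ?_⟩
  simp only [hscalar, Matrix.smul_one_pow_mulVec]
  refine ⟨fun h0 h1 => ?_, fun h k hk => ?_, fun h hv hlim => ?_⟩
  · have habs : |1 - 4 * θ| < 1 := abs_lt.mpr ⟨by linarith, by linarith⟩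
    simpa using (tendsto_pow_atTop_nhds_zero_of_abs_lt_one habs).smul_const v
  · have hzero : 1 - 4 * θ = 0 := by rw [h]; norm_num
    rw [hzero, zero_pow (by omega), zero_smul]
  · have habs : 1 ≤ |1 - 4 * θ| := le_abs.mpr (Or.inr (by linarith))
    have hnorm : Tendsto (fun k : ℕ => ‖(1 - 4 * θ) ^ k • v‖) atTop (𝓝 0) := by
      simpa using hlim.norm
    have hle : ‖v‖ ≤ 0 := ge_of_tendsto' hnorm fun k => by
      rw [norm_smul, norm_pow, Real.norm_eq_abs]
      exact le_mul_of_one_le_left (norm_nonneg v) (one_le_pow₀ habs)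
    exact hv (norm_le_zero_iff.mp hle)
end

section
/- Let a, b > 0 with a ≠ b, let δ, ε > 0 and c ≠ 0 be real with δ > 4ε²/c⁴, let λ₁ = (c²δ + √(c⁴δ² − 4ε²δ))/(2ε²δ), λ₂ = (c²δ − √(c⁴δ² − 4ε²δ))/(2ε²δ), ξ₁ = √λ₁, ξ₃ = √λ₂ (all real and positive), and for i ∈ {1,3} set ρᵢ = 2 + tanh(aξᵢ)/tanh(bξᵢ) + tanh(bξᵢ)/tanh(aξᵢ). Then the eigenvalues 1 − ρ₁/4 and 1 − ρ₂/4 of the Neumann–Neumann iteration matrix with θ = 1/4 satisfy 1 − ρᵢ/4 = −sinh²((a−b)ξᵢ)/(sinh(2aξᵢ)·sinh(2bξᵢ)), and hence |1 − ρᵢ/4| < (a−b)²/(4ab) for i ∈ {1,2}; in particular the spectral radius of the iteration matrix is strictly less than (a−b)²/(4ab). -/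
lemma sinh_le_mul_cosh {x : ℝ} (hx : 0 ≤ x) : Real.sinh x ≤ x * Real.cosh x := by
  have hd : ∀ z : ℝ, HasDerivAt (fun z => z * Real.cosh z - Real.sinh z) (z * Real.sinh z) z := by
    intro z
    refine HasDerivAt.congr_deriv
      (((hasDerivAt_id' z).mul (Real.hasDerivAt_cosh z)).sub (Real.hasDerivAt_sinh z)) ?_
    ring
  have hm : Monotone (fun z : ℝ => z * Real.cosh z - Real.sinh z) := by
    refine monotone_of_hasDerivAt_nonneg hd fun z => ?_
    rcases le_total 0 z with hz | hz
    · exact mul_nonneg hz (Real.sinh_nonneg_iff.2 hz)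
    · exact mul_nonneg_of_nonpos_of_nonpos hz (Real.sinh_nonpos_iff.2 hz)
  have := hm hx
  simp at this
  linarith

/-- `sinh z / z` is monotone on `(0, ∞)`, in cross-multiplied form. -/
lemma sinh_mul_le_mul_sinh {u x : ℝ} (hu : 0 < u) (hux : u ≤ x) :
    Real.sinh u * x ≤ u * Real.sinh x := by
  have hm : MonotoneOn (fun z : ℝ => Real.sinh z / z) (Set.Ioi 0) := by
    have hd : ∀ z ∈ Set.Ioi (0 : ℝ), HasDerivAt (fun z : ℝ => Real.sinh z / z)
        ((Real.cosh z * z - Real.sinh z * 1) / z ^ 2) z := fun z hz =>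
      (Real.hasDerivAt_sinh z).div (hasDerivAt_id z) (ne_of_gt hz)
    refine monotoneOn_of_deriv_nonneg (convex_Ioi 0)
      (fun z hz => (hd z hz).continuousAt.continuousWithinAt) ?_ ?_
    · rw [interior_Ioi]
      exact fun z hz => (hd z hz).differentiableAt.differentiableWithinAt
    · rw [interior_Ioi]
      intro z hz
      rw [(hd z hz).deriv]
      have := sinh_le_mul_cosh (le_of_lt hz)
      exact div_nonneg (by linarith) (sq_nonneg z)
  have h := hm (show u ∈ Set.Ioi 0 from hu) (show x ∈ Set.Ioi 0 from hu.trans_le hux) hux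
  have hx : 0 < x := hu.trans_le hux
  simp only [div_le_div_iff₀ hu hx] at h
  linarith

lemma sinh_sub_sq_mul_lt_of_lt {x y : ℝ} (hy : 0 < y) (hxy : y < x) :
    Real.sinh (x - y) ^ 2 * (4 * x * y) <
      (x - y) ^ 2 * (Real.sinh (2 * x) * Real.sinh (2 * y)) := by
  have hx : 0 < x := hy.trans hxy
  have hu : 0 < x - y := sub_pos.2 hxy
  have hS : 0 < Real.sinh x := Real.sinh_pos_iff.2 hx
  have hSu : 0 < Real.sinh (x - y) := Real.sinh_pos_iff.2 hu
  have h1 : (Real.sinh (x - y) * x) ^ 2 ≤ ((x - y) * Real.sinh x) ^ 2 :=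
    pow_le_pow_left₀ (by positivity) (sinh_mul_le_mul_sinh hu (by linarith)) 2
  have h2 : ((x - y) * Real.sinh x) ^ 2 ≤
      (x - y) ^ 2 * Real.sinh x * (x * Real.cosh x) := by
    have := mul_le_mul_of_nonneg_left (sinh_le_mul_cosh hx.le)
      (show 0 ≤ (x - y) ^ 2 * Real.sinh x by positivity)
    linarith
  have h3 : Real.sinh (x - y) ^ 2 * x ≤ (x - y) ^ 2 * Real.sinh x * Real.cosh x :=
    le_of_mul_le_mul_right (by linarith) hx
  have h4 : 2 * y < Real.sinh (2 * y) := Real.self_lt_sinh_iff.2 (by linarith)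
  have h5 : 0 < (x - y) ^ 2 * Real.sinh x * Real.cosh x :=
    mul_pos (by positivity) (Real.cosh_pos x)
  rw [Real.sinh_two_mul x]
  calc Real.sinh (x - y) ^ 2 * (4 * x * y)
      = 2 * (Real.sinh (x - y) ^ 2 * x) * (2 * y) := by ring
    _ ≤ 2 * ((x - y) ^ 2 * Real.sinh x * Real.cosh x) * (2 * y) := by gcongr
    _ < 2 * ((x - y) ^ 2 * Real.sinh x * Real.cosh x) * Real.sinh (2 * y) := by gcongr
    _ = _ := by ring

lemma sinh_sub_sq_div_lt {x y : ℝ} (hx : 0 < x) (hy : 0 < y) (hxy : x ≠ y) :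
    Real.sinh (x - y) ^ 2 / (Real.sinh (2 * x) * Real.sinh (2 * y)) <
      (x - y) ^ 2 / (4 * x * y) := by
  have h2x : 0 < Real.sinh (2 * x) := Real.sinh_pos_iff.2 (by linarith)
  have h2y : 0 < Real.sinh (2 * y) := Real.sinh_pos_iff.2 (by linarith)
  rw [div_lt_div_iff₀ (by positivity) (by positivity)]
  rcases lt_or_gt_of_ne hxy with h | h
  · have := sinh_sub_sq_mul_lt_of_lt hx h
    rw [← neg_sub y x, Real.sinh_neg]
    linarith
  · exact sinh_sub_sq_mul_lt_of_lt hy h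

lemma one_sub_tanh_ratio {x y : ℝ} (hx : 0 < x) (hy : 0 < y) :
    1 - (2 + Real.tanh x / Real.tanh y + Real.tanh y / Real.tanh x) / 4 =
      -(Real.sinh (x - y) ^ 2 / (Real.sinh (2 * x) * Real.sinh (2 * y))) := by
  have hsx : Real.sinh x ≠ 0 := (Real.sinh_pos_iff.2 hx).ne'
  have hsy : Real.sinh y ≠ 0 := (Real.sinh_pos_iff.2 hy).ne'
  have hcx : Real.cosh x ≠ 0 := (Real.cosh_pos x).ne'
  have hcy : Real.cosh y ≠ 0 := (Real.cosh_pos y).ne'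
  rw [Real.tanh_eq_sinh_div_cosh, Real.tanh_eq_sinh_div_cosh, Real.sinh_two_mul,
    Real.sinh_two_mul, Real.sinh_sub]
  field_simp
  ring

/-- The closed form and the strict bound for one eigenvalue `1 - ρ / 4`. -/
lemma neumann_neumann_eigenvalue {a b ξ ρ : ℝ} (ha : 0 < a) (hb : 0 < b) (hab : a ≠ b)
    (hξ : 0 < ξ)
    (hρ : ρ = 2 + Real.tanh (a * ξ) / Real.tanh (b * ξ)
        + Real.tanh (b * ξ) / Real.tanh (a * ξ)) :
    1 - ρ / 4 = -(Real.sinh ((a - b) * ξ) ^ 2 /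
        (Real.sinh (2 * a * ξ) * Real.sinh (2 * b * ξ))) ∧
    |1 - ρ / 4| < (a - b) ^ 2 / (4 * a * b) := by
  have hx : 0 < a * ξ := by positivity
  have hy : 0 < b * ξ := by positivity
  have heq := one_sub_tanh_ratio hx hy
  have hlt := sinh_sub_sq_div_lt hx hy fun h => hab (mul_right_cancel₀ hξ.ne' h)
  have h2x : 0 < Real.sinh (2 * (a * ξ)) := Real.sinh_pos_iff.2 (by linarith)
  have h2y : 0 < Real.sinh (2 * (b * ξ)) := Real.sinh_pos_iff.2 (by linarith)
  have hscale : (a * ξ - b * ξ) ^ 2 / (4 * (a * ξ) * (b * ξ)) = (a - b) ^ 2 / (4 * a * b) := by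
    field_simp
  rw [← hρ] at heq
  refine ⟨by rw [heq, sub_mul, mul_assoc, mul_assoc], ?_⟩
  rw [heq, abs_neg, abs_of_nonneg (by positivity), ← hscale]
  exact hlt


/-- Convergence of NN for the non-symmetric case, regime `δ > 4ε²/c⁴`: with
`λ₁, λ₂` the (real, positive) roots, `ξ₁ = √λ₁`, `ξ₃ = √λ₂`, and
`ρᵢ = 2 + tanh(aξᵢ)/tanh(bξᵢ) + tanh(bξᵢ)/tanh(aξᵢ)`, the eigenvalues
`1 − ρᵢ/4` of the Neumann–Neumann iteration matrix (θ = 1/4) satisfy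
`1 − ρᵢ/4 = −sinh²((a−b)ξᵢ)/(sinh(2aξᵢ)·sinh(2bξᵢ))` and
`|1 − ρᵢ/4| < (a−b)²/(4ab)`; in particular the spectral radius
`max(|1 − ρ₁/4|, |1 − ρ₂/4|)` is strictly less than `(a−b)²/(4ab)`. -/
theorem nn_nonsymmetric_convergence (a b δ ε c : ℝ)
    (ha : 0 < a) (hb : 0 < b) (hab : a ≠ b)
    (hδ : 0 < δ) (hε : 0 < ε) (hc : c ≠ 0) (hreg : δ > 4 * ε ^ 2 / c ^ 4)
    (lam₁ lam₂ ξ₁ ξ₃ ρ₁ ρ₂ : ℝ)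
    (hlam₁ : lam₁ = (c ^ 2 * δ + Real.sqrt (c ^ 4 * δ ^ 2 - 4 * ε ^ 2 * δ)) / (2 * ε ^ 2 * δ))
    (hlam₂ : lam₂ = (c ^ 2 * δ - Real.sqrt (c ^ 4 * δ ^ 2 - 4 * ε ^ 2 * δ)) / (2 * ε ^ 2 * δ))
    (hξ₁ : ξ₁ = Real.sqrt lam₁) (hξ₃ : ξ₃ = Real.sqrt lam₂)
    (hρ₁ : ρ₁ = 2 + Real.tanh (a * ξ₁) / Real.tanh (b * ξ₁)
        + Real.tanh (b * ξ₁) / Real.tanh (a * ξ₁))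
    (hρ₂ : ρ₂ = 2 + Real.tanh (a * ξ₃) / Real.tanh (b * ξ₃)
        + Real.tanh (b * ξ₃) / Real.tanh (a * ξ₃)) :
    1 - ρ₁ / 4 = -(Real.sinh ((a - b) * ξ₁) ^ 2 /
        (Real.sinh (2 * a * ξ₁) * Real.sinh (2 * b * ξ₁))) ∧
    1 - ρ₂ / 4 = -(Real.sinh ((a - b) * ξ₃) ^ 2 /
        (Real.sinh (2 * a * ξ₃) * Real.sinh (2 * b * ξ₃))) ∧
    |1 - ρ₁ / 4| < (a - b) ^ 2 / (4 * a * b) ∧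
    |1 - ρ₂ / 4| < (a - b) ^ 2 / (4 * a * b) ∧
    max |1 - ρ₁ / 4| |1 - ρ₂ / 4| < (a - b) ^ 2 / (4 * a * b) := by
  have hc2 : 0 < c ^ 2 * δ := by positivity
  have hden : 0 < 2 * ε ^ 2 * δ := by positivity
  have hsqrt : Real.sqrt (c ^ 4 * δ ^ 2 - 4 * ε ^ 2 * δ) < c ^ 2 * δ := by
    rw [Real.sqrt_lt' hc2]
    have : 0 < 4 * ε ^ 2 * δ := by positivity
    linarith
  have hξ₁pos : 0 < ξ₁ := by
    rw [hξ₁, hlam₁]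
    exact Real.sqrt_pos.2 (by positivity)
  have hξ₃pos : 0 < ξ₃ := by
    rw [hξ₃, hlam₂]
    exact Real.sqrt_pos.2 (div_pos (sub_pos.2 hsqrt) hden)
  obtain ⟨e₁, l₁⟩ := neumann_neumann_eigenvalue ha hb hab hξ₁pos hρ₁
  obtain ⟨e₂, l₂⟩ := neumann_neumann_eigenvalue ha hb hab hξ₃pos hρ₂
  exact ⟨e₁, e₂, l₁, l₂, max_lt l₁ l₂⟩
end
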